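/- Every graph obtained by gluing together finitely many even cycles successively along single edges is a Sidorenko graph, i.e., t(H, W) ≥ (∫∫ W)^{|E(H)|} for every bounded symmetric measurable W : [0,1]² → ℝ≥0. -/

import Mathlib

open MeasureTheory Real unitInterval

open scoped Classical in
/-- A graph `H` is Sidorenko if `t(H, W) ≥ (∫∫ W)^{|E(H)|}` for every bounded
symmetric measurable `W : [0,1]² → ℝ≥0`. -/
def IsSidorenko {V : Type} [Fintype V] [DecidableEq V] (H : SimpleGraph V) : Prop :=
  ∀ (W : I → I → ℝ), Measurable (Function.uncurry W) → (∀ x y, 0 ≤ W x y) →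
    (∃ C : ℝ, ∀ x y, W x y ≤ C) → ∀ (hsym : ∀ x y, W x y = W y x),
    (∫ x : V → I, ∏ e ∈ H.edgeFinset,
        Sym2.lift ⟨fun a b => W (x a) (x b), fun a b => hsym (x a) (x b)⟩ e)
      ≥ (∫ u : I, ∫ v : I, W u v) ^ H.edgeFinset.card

/-- The class of graphs obtained by successively gluing finitely many even cycles along
single edges: either an even cycle itself, or a graph obtained by gluing an even cycle
onto a previously constructed graph along an edge (the gluing being described via
injections covering the new graph and meeting exactly in the glued edge). -/
inductive GluedEvenCycles : ∀ (V : Type), SimpleGraph V → Prop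
  | base (V : Type) (H : SimpleGraph V) (m : ℕ) (hm : 2 ≤ m)
      (hiso : Nonempty (H ≃g SimpleGraph.cycleGraph (2 * m))) : GluedEvenCycles V H
  | glue (V₁ V₂ V : Type) (H₁ : SimpleGraph V₁) (H₂ : SimpleGraph V₂) (H : SimpleGraph V)
      (a₁ b₁ : V₁) (a₂ b₂ : V₂) (he₁ : H₁.Adj a₁ b₁) (he₂ : H₂.Adj a₂ b₂)
      (i₁ : V₁ → V) (i₂ : V₂ → V)
      (hinj₁ : Function.Injective i₁) (hinj₂ : Function.Injective i₂)
      (hcover : ∀ v : V, (∃ u, i₁ u = v) ∨ (∃ u, i₂ u = v))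
      (ha : i₁ a₁ = i₂ a₂) (hb : i₁ b₁ = i₂ b₂)
      (hmeet : ∀ u₁ u₂, i₁ u₁ = i₂ u₂ → (u₁ = a₁ ∧ u₂ = a₂) ∨ (u₁ = b₁ ∧ u₂ = b₂))
      (hadj : ∀ v w : V, H.Adj v w ↔
        ((∃ u₁ u₂, i₁ u₁ = v ∧ i₁ u₂ = w ∧ H₁.Adj u₁ u₂) ∨
          (∃ u₁ u₂, i₂ u₁ = v ∧ i₂ u₂ = w ∧ H₂.Adj u₁ u₂)))
      (h₁ : GluedEvenCycles V₁ H₁)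
      (m : ℕ) (hm : 2 ≤ m)
      (h₂ : Nonempty (H₂ ≃g SimpleGraph.cycleGraph (2 * m))) : GluedEvenCycles V H

/-- A measurable real function bounded in absolute value. -/
structure BddMeas {α : Type*} [MeasurableSpace α] (f : α → ℝ) : Prop where
  meas : Measurable f
  bdd : ∃ C : ℝ, ∀ x, |f x| ≤ C

/-- A measurable real function bounded above, and bounded below by a positive constant. -/
structure PosBdd {α : Type*} [MeasurableSpace α] (f : α → ℝ) : Prop where
  meas : Measurable f
  lower : ∃ c : ℝ, 0 < c ∧ ∀ x, c ≤ f x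
  upper : ∃ C : ℝ, ∀ x, f x ≤ C

section Bounded

variable {α β : Type*} [MeasurableSpace α] [MeasurableSpace β]

lemma BddMeas.integrable {f : α → ℝ} (hf : BddMeas f) (μ : Measure α) [IsFiniteMeasure μ] :
    Integrable f μ := by
  obtain ⟨C, hC⟩ := hf.bdd
  exact Integrable.of_bound hf.meas.aestronglyMeasurable C (.of_forall hC)

lemma BddMeas.comp {f : α → ℝ} (hf : BddMeas f) {φ : β → α} (hφ : Measurable φ) :
    BddMeas (fun x => f (φ x)) := by
  obtain ⟨C, hC⟩ := hf.bdd
  exact ⟨hf.meas.comp hφ, C, fun x => hC _⟩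

lemma BddMeas.mul {f g : α → ℝ} (hf : BddMeas f) (hg : BddMeas g) :
    BddMeas (fun x => f x * g x) := by
  obtain ⟨C, hC⟩ := hf.bdd
  obtain ⟨D, hD⟩ := hg.bdd
  refine ⟨hf.meas.mul hg.meas, C * D, fun x => ?_⟩
  rw [abs_mul]
  exact mul_le_mul (hC x) (hD x) (abs_nonneg _) ((abs_nonneg _).trans (hC x))

lemma BddMeas.add {f g : α → ℝ} (hf : BddMeas f) (hg : BddMeas g) :
    BddMeas (fun x => f x + g x) := by
  obtain ⟨C, hC⟩ := hf.bdd
  obtain ⟨D, hD⟩ := hg.bdd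
  exact ⟨hf.meas.add hg.meas, C + D, fun x => (abs_add_le _ _).trans (add_le_add (hC x) (hD x))⟩

lemma BddMeas.sub {f g : α → ℝ} (hf : BddMeas f) (hg : BddMeas g) :
    BddMeas (fun x => f x - g x) := by
  obtain ⟨C, hC⟩ := hf.bdd
  obtain ⟨D, hD⟩ := hg.bdd
  exact ⟨hf.meas.sub hg.meas, C + D, fun x => (abs_sub _ _).trans (add_le_add (hC x) (hD x))⟩

lemma BddMeas.integral_right {f : α × β → ℝ} (hf : BddMeas f) (μ : Measure β)
    [IsProbabilityMeasure μ] : BddMeas (fun a => ∫ b, f (a, b) ∂μ) := by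
  obtain ⟨C, hC⟩ := hf.bdd
  refine ⟨hf.meas.stronglyMeasurable.integral_prod_right'.measurable, C, fun x => ?_⟩
  simpa using norm_integral_le_of_norm_le_const (μ := μ) (f := fun b => f (x, b))
    (.of_forall fun b => hC (x, b))

lemma PosBdd.pos {f : α → ℝ} (hf : PosBdd f) (x : α) : 0 < f x := by
  obtain ⟨c, hc, h⟩ := hf.lower
  exact hc.trans_le (h x)

lemma PosBdd.bddMeas {f : α → ℝ} (hf : PosBdd f) : BddMeas f := by
  obtain ⟨C, hC⟩ := hf.upper
  exact ⟨hf.meas, C, fun x => by rw [abs_of_pos (hf.pos x)]; exact hC x⟩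

lemma PosBdd.log {f : α → ℝ} (hf : PosBdd f) : BddMeas (fun x => Real.log (f x)) := by
  obtain ⟨c, hc, h⟩ := hf.lower
  obtain ⟨C, hC⟩ := hf.upper
  refine ⟨hf.meas.log, max (-Real.log c) (Real.log C), fun x => ?_⟩
  have h1 := Real.log_le_log hc (h x)
  have h2 := Real.log_le_log (hf.pos x) (hC x)
  exact abs_le.2 ⟨by linarith [le_max_left (-Real.log c) (Real.log C)],
    h2.trans (le_max_right _ _)⟩

lemma PosBdd.comp {f : α → ℝ} (hf : PosBdd f) {φ : β → α} (hφ : Measurable φ) :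
    PosBdd (fun x => f (φ x)) := by
  obtain ⟨c, hc, h⟩ := hf.lower
  obtain ⟨C, hC⟩ := hf.upper
  exact ⟨hf.meas.comp hφ, ⟨c, hc, fun x => h _⟩, C, fun x => hC _⟩

lemma PosBdd.const {c : ℝ} (hc : 0 < c) : PosBdd (fun _ : α => c) :=
  ⟨measurable_const, ⟨c, hc, fun _ => le_rfl⟩, c, fun _ => le_rfl⟩

lemma PosBdd.mul {f g : α → ℝ} (hf : PosBdd f) (hg : PosBdd g) :
    PosBdd (fun x => f x * g x) := by
  obtain ⟨c, hc, h⟩ := hf.lower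
  obtain ⟨C, hC⟩ := hf.upper
  obtain ⟨d, hd, h'⟩ := hg.lower
  obtain ⟨D, hD⟩ := hg.upper
  exact ⟨hf.meas.mul hg.meas,
    ⟨c * d, mul_pos hc hd, fun x => mul_le_mul (h x) (h' x) hd.le (hf.pos x).le⟩,
    C * D, fun x => mul_le_mul (hC x) (hD x) (hg.pos x).le ((hf.pos x).le.trans (hC x))⟩

lemma PosBdd.inv {f : α → ℝ} (hf : PosBdd f) : PosBdd (fun x => (f x)⁻¹) := by
  obtain ⟨c, hc, h⟩ := hf.lower
  obtain ⟨C, hC⟩ := hf.upper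
  refine ⟨hf.meas.inv, ⟨(max C 1)⁻¹, by positivity, fun x => ?_⟩, c⁻¹, fun x => ?_⟩
  · exact inv_anti₀ (hf.pos x) ((hC x).trans (le_max_left _ _))
  · exact inv_anti₀ hc (h x)

lemma PosBdd.div {f g : α → ℝ} (hf : PosBdd f) (hg : PosBdd g) :
    PosBdd (fun x => f x / g x) := by
  simpa only [div_eq_mul_inv] using hf.mul hg.inv

lemma PosBdd.prod {ι : Type*} (s : Finset ι) {f : ι → α → ℝ} (hf : ∀ i, PosBdd (f i)) :
    PosBdd (fun x => ∏ i ∈ s, f i x) := by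
  classical
  induction s using Finset.induction_on with
  | empty => simpa using PosBdd.const one_pos
  | insert i s hi ih =>
    simp only [Finset.prod_insert hi]
    exact (hf i).mul ih

lemma PosBdd.integral_right {f : α × β → ℝ} (hf : PosBdd f) (μ : Measure β)
    [IsProbabilityMeasure μ] : PosBdd (fun a => ∫ b, f (a, b) ∂μ) := by
  obtain ⟨c, hc, h⟩ := hf.lower
  obtain ⟨C, hC⟩ := hf.upper
  have hi : ∀ a, Integrable (fun b => f (a, b)) μ := fun a =>
    (hf.bddMeas.comp measurable_prodMk_left).integrable μ
  refine ⟨(hf.bddMeas.integral_right μ).meas, ⟨c, hc, fun a => ?_⟩, C, fun a => ?_⟩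
  · simpa using integral_mono (integrable_const c) (hi a) fun b => h (a, b)
  · simpa using integral_mono (hi a) (integrable_const C) fun b => hC (a, b)

lemma PosBdd.integral_pos {f : α → ℝ} (hf : PosBdd f) (μ : Measure α)
    [IsProbabilityMeasure μ] : 0 < ∫ x, f x ∂μ := by
  obtain ⟨c, hc, h⟩ := hf.lower
  refine hc.trans_le ?_
  simpa using integral_mono (integrable_const c) (hf.bddMeas.integrable μ) h

/-- The log-sum inequality. -/
lemma integral_mul_log_sub_log_le {a b : α → ℝ} (ha : PosBdd a) (hb : PosBdd b)
    (μ : Measure α) [IsProbabilityMeasure μ] :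
    ∫ x, a x * (Real.log (b x) - Real.log (a x)) ∂μ ≤
      (∫ x, a x ∂μ) * (Real.log (∫ x, b x ∂μ) - Real.log (∫ x, a x ∂μ)) := by
  set A := ∫ x, a x ∂μ with hA
  set B := ∫ x, b x ∂μ with hB
  have hA0 : 0 < A := ha.integral_pos μ
  have hB0 : 0 < B := hb.integral_pos μ
  have hai := ha.bddMeas.integrable μ
  have hbi := hb.bddMeas.integrable μ
  have key : ∀ x, a x * (Real.log (b x) - Real.log (a x)) ≤
      a x * (Real.log B - Real.log A - 1) + b x * (A / B) := fun x => by
    have hax := ha.pos x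
    have hbx := hb.pos x
    have h := Real.log_le_sub_one_of_pos (x := b x * A / (a x * B)) (by positivity)
    rw [Real.log_div (by positivity) (by positivity), Real.log_mul hbx.ne' hA0.ne',
      Real.log_mul hax.ne' hB0.ne'] at h
    have h2 := mul_le_mul_of_nonneg_left h hax.le
    have h3 : a x * (b x * A / (a x * B) - 1) = b x * (A / B) - a x := by
      field_simp
    rw [h3] at h2
    nlinarith
  refine (integral_mono ((ha.bddMeas.mul (hb.log.sub ha.log)).integrable μ)
    ((hai.mul_const _).add (hbi.mul_const _)) key).trans_eq ?_
  simp only [Pi.add_apply]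
  rw [integral_add (hai.mul_const _) (hbi.mul_const _), integral_mul_const, integral_mul_const,
    ← hA, ← hB]
  field_simp
  ring

lemma integral_mul_log_nonneg {a : α → ℝ} (ha : PosBdd a) (μ : Measure α)
    [IsProbabilityMeasure μ] (h1 : ∫ x, a x ∂μ = 1) : 0 ≤ ∫ x, a x * Real.log (a x) ∂μ := by
  have h := integral_mul_log_sub_log_le ha (PosBdd.const one_pos) μ
  simp only [Real.log_one, zero_sub, mul_neg, integral_neg, h1] at h
  simpa using h

end Bounded

/-- The composition of two kernels on `[0,1]`. -/
noncomputable def kernelConv (G g : I × I → ℝ) : I × I → ℝ :=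
  fun p => ∫ w, G (p.1, w) * g (w, p.2)

/-- The composition of the kernels `g 0, …, g n`. -/
noncomputable def pathKernel (g : ℕ → I × I → ℝ) : ℕ → I × I → ℝ
  | 0 => g 0
  | n + 1 => kernelConv (pathKernel g n) (g (n + 1))

/-- The expectation of `log (G / K)` under the density `K`. -/
noncomputable def logRatio (K G : I × I → ℝ) : ℝ :=
  ∫ p, K p * (Real.log (G p) - Real.log (K p))

lemma PosBdd.kernelConv {G g : I × I → ℝ} (hG : PosBdd G) (hg : PosBdd g) :
    PosBdd (kernelConv G g) :=
  PosBdd.integral_right (f := fun q : (I × I) × I => G (q.1.1, q.2) * g (q.2, q.1.2))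
    ((hG.comp (by fun_prop)).mul (hg.comp (by fun_prop))) volume

lemma PosBdd.pathKernel {g : ℕ → I × I → ℝ} (hg : ∀ n, PosBdd (g n)) (n : ℕ) :
    PosBdd (pathKernel g n) := by
  induction n with
  | zero => exact hg 0
  | succ n ih => exact ih.kernelConv (hg _)

lemma BddMeas.integral_prod_eq {f : I × I → ℝ} (hf : BddMeas f) :
    ∫ p, f p = ∫ x, ∫ y, f (x, y) := by
  rw [Measure.volume_eq_prod]
  exact integral_prod _ (hf.integrable _)

lemma BddMeas.integral_swap {f : I × I → ℝ} (hf : BddMeas f) :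
    ∫ x, ∫ y, f (x, y) = ∫ y, ∫ x, f (x, y) :=
  integral_integral_swap (f := fun x y => f (x, y)) (hf.integrable _)

lemma integral_comp_swap (f : I × I → ℝ) : ∫ p : I × I, f p.swap = ∫ p, f p := by
  rw [Measure.volume_eq_prod]
  exact integral_prod_swap f

lemma BddMeas.integral_triple {f : I × I × I → ℝ} (hf : BddMeas f) :
    ∫ p : I × I, ∫ w, f (p.1, w, p.2) = ∫ u, ∫ w, ∫ v, f (u, w, v) := by
  have h1 : BddMeas (fun q : (I × I) × I => f (q.1.1, q.2, q.1.2)) := hf.comp (by fun_prop)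
  rw [(h1.integral_right volume).integral_prod_eq]
  refine integral_congr_ae (.of_forall fun u => ?_)
  exact BddMeas.integral_swap (f := fun q : I × I => f (u, q.2, q.1)) (hf.comp (by fun_prop))

lemma BddMeas.integral_triple_rotate {f : I × I × I → ℝ} (hf : BddMeas f) :
    ∫ u, ∫ w, ∫ v, f (u, w, v) = ∫ w, ∫ v, ∫ u, f (u, w, v) := by
  have h1 : BddMeas (fun q : (I × I) × I => f (q.1.1, q.1.2, q.2)) := hf.comp (by fun_prop)
  rw [BddMeas.integral_swap (f := fun q : I × I => ∫ v, f (q.1, q.2, v))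
    (h1.integral_right volume)]
  refine integral_congr_ae (.of_forall fun w => ?_)
  exact BddMeas.integral_swap (f := fun q : I × I => f (q.1, w, q.2)) (hf.comp (by fun_prop))

/-- Right composition with `g` is adjoint to right composition with its transpose. -/
lemma integral_mul_kernelConv_swap {A B g : I × I → ℝ} (hA : PosBdd A) (hB : PosBdd B)
    (hg : PosBdd g) :
    ∫ p, A p * kernelConv B (fun q => g q.swap) p = ∫ p, kernelConv A g p * B p := by
  have hf : BddMeas (fun q : I × I × I => A (q.1, q.2.1) * g (q.2.1, q.2.2) * B (q.1, q.2.2)) :=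
    (((hA.comp (by fun_prop)).mul (hg.comp (by fun_prop))).mul (hB.comp (by fun_prop))).bddMeas
  have h1 : ∫ p, A p * kernelConv B (fun q => g q.swap) p =
      ∫ u, ∫ w, ∫ v, A (u, w) * g (w, v) * B (u, v) := by
    rw [(hA.mul (hB.kernelConv (hg.comp measurable_swap))).bddMeas.integral_prod_eq]
    simp only [kernelConv, Prod.swap, ← integral_const_mul]
    simp only [mul_comm, mul_left_comm]
  have h2 : ∫ p, kernelConv A g p * B p =
      ∫ p : I × I, ∫ w, A (p.1, w) * g (w, p.2) * B (p.1, p.2) := by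
    simp only [kernelConv, ← integral_mul_const]
  rw [h1, h2]
  exact hf.integral_triple.symm

/-- A symmetric probability density on `[0,1]²`, bounded and bounded away from zero. -/
structure EdgeDensity (W : I × I → ℝ) : Prop where
  posBdd : PosBdd W
  symm : ∀ x y, W (x, y) = W (y, x)
  total : ∫ p, W p = 1

/-- The vertex marginal of a density on `[0,1]²`. -/
noncomputable def marginal (W : I × I → ℝ) (x : I) : ℝ := ∫ y, W (x, y)

/-- The kernels whose composition is the end-point density of the stationary Markov chain
with edge density `W`. -/
noncomputable def chainStep (W : I × I → ℝ) : ℕ → I × I → ℝ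
  | 0 => W
  | _ + 1 => fun p => W p / marginal W p.1

namespace EdgeDensity

variable {W : I × I → ℝ}

lemma marginal_posBdd (hW : EdgeDensity W) : PosBdd (marginal W) :=
  hW.posBdd.integral_right volume

lemma chainStep_posBdd (hW : EdgeDensity W) (n : ℕ) : PosBdd (chainStep W n) := by
  cases n with
  | zero => exact hW.posBdd
  | succ n => exact hW.posBdd.div (hW.marginal_posBdd.comp measurable_fst)

lemma integral_left (hW : EdgeDensity W) (y : I) : ∫ x, W (x, y) = marginal W y := by
  simp only [marginal, hW.symm _ y]

lemma integral_marginal (hW : EdgeDensity W) : ∫ x, marginal W x = 1 := by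
  rw [← hW.total, hW.posBdd.bddMeas.integral_prod_eq]
  rfl

lemma integral_chainStep_left (hW : EdgeDensity W) (n : ℕ) (y : I) :
    ∫ x, pathKernel (chainStep W) n (x, y) = marginal W y := by
  induction n generalizing y with
  | zero => exact hW.integral_left y
  | succ n ih =>
    have hK := PosBdd.pathKernel hW.chainStep_posBdd n
    have hM := hW.chainStep_posBdd (n + 1)
    simp only [pathKernel, kernelConv]
    rw [BddMeas.integral_swap
      (f := fun q : I × I => pathKernel (chainStep W) n (q.1, q.2) * chainStep W (n + 1) (q.2, y))
      ((hK.mul (hM.comp (by fun_prop))).bddMeas)]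
    simp only [integral_mul_const, ih]
    rw [← hW.integral_left y]
    refine integral_congr_ae (.of_forall fun w => ?_)
    simp only [chainStep]
    exact mul_div_cancel₀ _ (hW.marginal_posBdd.pos w).ne'

lemma logRatio_add_le_kernelConv (hW : EdgeDensity W) {K G g : I × I → ℝ} (hK : PosBdd K)
    (hG : PosBdd G) (hg : PosBdd g) (hKW : ∀ w, ∫ u, K (u, w) = marginal W w) (n : ℕ) :
    logRatio K G + logRatio W g ≤
      logRatio (kernelConv K (chainStep W (n + 1))) (kernelConv G g) := by
  set M := chainStep W (n + 1) with hMdef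
  have hM : PosBdd M := hW.chainStep_posBdd (n + 1)
  have hd := hW.marginal_posBdd
  have hMW : ∀ w v, marginal W w * M (w, v) = W (w, v) := fun w v => by
    simp only [hMdef, chainStep]
    exact mul_div_cancel₀ _ (hd.pos w).ne'
  have hM1 : ∀ w, ∫ v, M (w, v) = 1 := fun w => by
    simp only [hMdef, chainStep, integral_div]
    exact div_self (hd.pos w).ne'
  let φ : I × I → ℝ := fun q => Real.log (G q) - Real.log (K q) + Real.log (marginal W q.2)
  let ψ : I × I → ℝ := fun q => Real.log (g q) - Real.log (W q)
  have hφ : BddMeas φ := (hG.log.sub hK.log).add (hd.comp measurable_snd).log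
  have hψ : BddMeas ψ := hg.log.sub hW.posBdd.log
  have ha : PosBdd (fun q : (I × I) × I => K (q.1.1, q.2) * M (q.2, q.1.2)) :=
    (hK.comp (by fun_prop)).mul (hM.comp (by fun_prop))
  have hb : PosBdd (fun q : (I × I) × I => G (q.1.1, q.2) * g (q.2, q.1.2)) :=
    (hG.comp (by fun_prop)).mul (hg.comp (by fun_prop))
  have hf1 : BddMeas (fun q : I × I × I => K (q.1, q.2.1) * M (q.2.1, q.2.2) * φ (q.1, q.2.1)) :=
    ((hK.comp (by fun_prop)).mul (hM.comp (by fun_prop))).bddMeas.mul (hφ.comp (by fun_prop))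
  have hf2 : BddMeas (fun q : I × I × I => K (q.1, q.2.1) * M (q.2.1, q.2.2) * ψ (q.2.1, q.2.2)) :=
    ((hK.comp (by fun_prop)).mul (hM.comp (by fun_prop))).bddMeas.mul (hψ.comp (by fun_prop))
  have hpt : ∀ (p : I × I) (w : I), K (p.1, w) * M (w, p.2) *
      (Real.log (G (p.1, w) * g (w, p.2)) - Real.log (K (p.1, w) * M (w, p.2))) =
      K (p.1, w) * M (w, p.2) * φ (p.1, w) + K (p.1, w) * M (w, p.2) * ψ (w, p.2) := by
    intro p w
    rw [Real.log_mul (hG.pos _).ne' (hg.pos _).ne', Real.log_mul (hK.pos _).ne' (hM.pos _).ne',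
      show Real.log (M (w, p.2)) = Real.log (W (w, p.2)) - Real.log (marginal W w) from
        Real.log_div (hW.posBdd.pos _).ne' (hd.pos _).ne']
    simp only [φ, ψ]
    ring
  have hlow : ∫ p : I × I, ∫ w, K (p.1, w) * M (w, p.2) *
      (Real.log (G (p.1, w) * g (w, p.2)) - Real.log (K (p.1, w) * M (w, p.2))) ≤
      logRatio (kernelConv K M) (kernelConv G g) := by
    refine integral_mono
      ((BddMeas.integral_right (ha.bddMeas.mul (hb.log.sub ha.log)) volume).integrable _)
      (((hK.kernelConv hM).bddMeas.mul
        ((hG.kernelConv hg).log.sub (hK.kernelConv hM).log)).integrable _) fun p => ?_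
    exact integral_mul_log_sub_log_le (a := fun w => K (p.1, w) * M (w, p.2))
      (b := fun w => G (p.1, w) * g (w, p.2))
      (ha.comp (φ := fun w => (p, w)) (by fun_prop))
      (hb.comp (φ := fun w => (p, w)) (by fun_prop)) volume
  refine le_trans ?_ hlow
  have hsplit : ∫ p : I × I, ∫ w, K (p.1, w) * M (w, p.2) *
      (Real.log (G (p.1, w) * g (w, p.2)) - Real.log (K (p.1, w) * M (w, p.2))) =
      (∫ p : I × I, ∫ w, K (p.1, w) * M (w, p.2) * φ (p.1, w)) +
      ∫ p : I × I, ∫ w, K (p.1, w) * M (w, p.2) * ψ (w, p.2) := by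
    have e1 : BddMeas (fun q : (I × I) × I => K (q.1.1, q.2) * M (q.2, q.1.2) * φ (q.1.1, q.2)) :=
      ha.bddMeas.mul (hφ.comp (by fun_prop))
    have e2 : BddMeas (fun q : (I × I) × I => K (q.1.1, q.2) * M (q.2, q.1.2) * ψ (q.2, q.1.2)) :=
      ha.bddMeas.mul (hψ.comp (by fun_prop))
    rw [← integral_add ((e1.integral_right volume).integrable _)
      ((e2.integral_right volume).integrable _)]
    refine integral_congr_ae (.of_forall fun p => ?_)
    simp only [hpt]
    exact integral_add ((e1.comp (φ := fun w => (p, w)) (by fun_prop)).integrable _)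
      ((e2.comp (φ := fun w => (p, w)) (by fun_prop)).integrable _)
  have hT1 : ∫ p : I × I, ∫ w, K (p.1, w) * M (w, p.2) * φ (p.1, w) =
      logRatio K G + ∫ w, marginal W w * Real.log (marginal W w) := by
    rw [hf1.integral_triple]
    have : ∀ u w, ∫ v, K (u, w) * M (w, v) * φ (u, w) = K (u, w) * φ (u, w) := fun u w => by
      rw [integral_mul_const, integral_const_mul, hM1, mul_one]
    simp only [this]
    have hl : BddMeas (fun q : I × I => K q * Real.log (marginal W q.2)) :=
      hK.bddMeas.mul (hd.comp measurable_snd).log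
    rw [← (hK.bddMeas.mul hφ).integral_prod_eq]
    simp only [φ, mul_add]
    rw [integral_add ((hK.bddMeas.mul (hG.log.sub hK.log)).integrable _) (hl.integrable _),
      hl.integral_prod_eq, hl.integral_swap]
    simp only [integral_mul_const, hKW]
    rfl
  have hT2 : ∫ p : I × I, ∫ w, K (p.1, w) * M (w, p.2) * ψ (w, p.2) = logRatio W g := by
    rw [hf2.integral_triple, hf2.integral_triple_rotate]
    simp only [integral_mul_const, hKW, hMW]
    exact (hW.posBdd.bddMeas.mul hψ).integral_prod_eq.symm
  have hT3 := integral_mul_log_nonneg hd volume hW.integral_marginal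
  rw [hsplit, hT1, hT2]
  linarith

lemma sum_logRatio_le_pathKernel (hW : EdgeDensity W) {g : ℕ → I × I → ℝ}
    (hg : ∀ n, PosBdd (g n)) (n : ℕ) :
    ∑ j ∈ Finset.range (n + 1), logRatio W (g j) ≤
      logRatio (pathKernel (chainStep W) n) (pathKernel g n) := by
  induction n with
  | zero => simp [pathKernel, chainStep]
  | succ n ih =>
    rw [Finset.sum_range_succ]
    have := hW.logRatio_add_le_kernelConv (PosBdd.pathKernel hW.chainStep_posBdd n)
      (PosBdd.pathKernel hg n) (hg (n + 1)) (hW.integral_chainStep_left n) n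
    simp only [pathKernel]
    linarith

lemma logRatio_swap (hW : EdgeDensity W) (g : I × I → ℝ) :
    logRatio W (fun q => g q.swap) = logRatio W g := by
  unfold logRatio
  rw [← integral_comp_swap (fun p => W p * (Real.log (g p) - Real.log (W p)))]
  have : ∀ p : I × I, W p.swap = W p := fun p => hW.symm _ _
  simp only [this]

/-- The edge `W` of an even cycle is smooth: the remaining path, of odd length, has large
logarithmic expectation between the end points of a `W`-random edge. -/
lemma sum_logRatio_le_integral_log_pathKernel (hW : EdgeDensity W) {g : ℕ → I × I → ℝ}
    (hg : ∀ n, PosBdd (g n)) (m : ℕ) :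
    ∑ j ∈ Finset.range (2 * m + 1), logRatio W (g j) ≤
      ∫ p, W p * Real.log (pathKernel g (2 * m) p) := by
  set h := pathKernel g (2 * m) with hh
  have hhp : PosBdd h := PosBdd.pathKernel hg _
  let g' : ℕ → I × I → ℝ := fun j =>
    Nat.casesOn j (fun q => W q / h q) fun j q => g (2 * m - j) q.swap
  have hg' : ∀ n, PosBdd (g' n) := fun n => by
    cases n with
    | zero => exact hW.posBdd.div hhp
    | succ n => exact (hg _).comp measurable_swap
  have hadj : ∀ j ≤ 2 * m, ∫ p, pathKernel g (2 * m - j) p * pathKernel g' j p = 1 := by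
    intro j
    induction j with
    | zero =>
      intro _
      rw [← hW.total]
      refine integral_congr_ae (.of_forall fun p => ?_)
      exact mul_div_cancel₀ _ (hhp.pos p).ne'
    | succ j ih =>
      intro hj
      rw [← ih (by omega)]
      obtain ⟨k, hk⟩ : ∃ k, 2 * m - j = k + 1 := ⟨2 * m - j - 1, by omega⟩
      have e1 : 2 * m - (j + 1) = k := by omega
      have e2 : pathKernel g' (j + 1) = kernelConv (pathKernel g' j) (fun q => g (k + 1) q.swap) := by
        simp only [pathKernel, g', hk]
      rw [e1, e2, hk, integral_mul_kernelConv_swap (PosBdd.pathKernel hg _)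
        (PosBdd.pathKernel hg' _) (hg _)]
      rfl
  set K := pathKernel (chainStep W) m with hKdef
  have hK : PosBdd K := PosBdd.pathKernel hW.chainStep_posBdd m
  have hG1 : PosBdd (pathKernel g m) := PosBdd.pathKernel hg m
  have hG2 : PosBdd (pathKernel g' m) := PosBdd.pathKernel hg' m
  have hK1 : ∫ p, K p = 1 := by
    rw [hK.bddMeas.integral_prod_eq, hK.bddMeas.integral_swap]
    simp only [hKdef, hW.integral_chainStep_left]
    exact hW.integral_marginal
  have hls := integral_mul_log_sub_log_le hK (hG1.mul hG2) volume
  have hprod := hadj m (by omega)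
  rw [show 2 * m - m = m by omega] at hprod
  rw [hprod, hK1] at hls
  have hKK := integral_mul_log_nonneg hK volume hK1
  have hsplit : ∫ p, K p * (Real.log (pathKernel g m p * pathKernel g' m p) - Real.log (K p)) =
      logRatio K (pathKernel g m) + logRatio K (pathKernel g' m) + ∫ p, K p * Real.log (K p) := by
    unfold logRatio
    have i1 := (hK.bddMeas.mul (hG1.log.sub hK.log)).integrable volume
    have i2 := (hK.bddMeas.mul (hG2.log.sub hK.log)).integrable volume
    have i3 := (hK.bddMeas.mul hK.log).integrable volume
    rw [← integral_add i1 i2, ← integral_add ?_ i3]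
    rotate_left
    · exact i1.add i2
    refine integral_congr_ae (.of_forall fun p => ?_)
    beta_reduce
    rw [Real.log_mul (hG1.pos p).ne' (hG2.pos p).ne']
    ring
  have hs1 := hW.sum_logRatio_le_pathKernel hg m
  have hs2 := hW.sum_logRatio_le_pathKernel hg' m
  have h0 : logRatio W (g' 0) = - ∫ p, W p * Real.log (h p) := by
    unfold logRatio
    rw [← integral_neg]
    refine integral_congr_ae (.of_forall fun p => ?_)
    change W p * (Real.log (W p / h p) - Real.log (W p)) = -(W p * Real.log (h p))
    rw [Real.log_div (hW.posBdd.pos p).ne' (hhp.pos p).ne']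
    ring
  have hrest : ∑ j ∈ Finset.range m, logRatio W (g' (j + 1)) =
      ∑ j ∈ Finset.range m, logRatio W (g (m + 1 + j)) := by
    rw [← Finset.sum_range_reflect]
    refine Finset.sum_congr rfl fun j hj => ?_
    have hj' := Finset.mem_range.1 hj
    simp only [g']
    rw [hW.logRatio_swap, show 2 * m - (m - 1 - j) = m + 1 + j by omega]
  rw [Finset.sum_range_succ', h0, hrest] at hs2
  rw [show 2 * m + 1 = (m + 1) + m by ring, Finset.sum_range_add]
  rw [hsplit] at hls
  simp only [Real.log_one, sub_self, mul_zero] at hls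
  linarith

end EdgeDensity

/-- The integral over the `n` interior vertices of a path is a composition of kernels. -/
lemma integral_path_eq_pathKernel {g : ℕ → I × I → ℝ} (hg : ∀ n, PosBdd (g n)) (n : ℕ)
    (u v : I) :
    ∫ z : Fin n → I, ∏ j : Fin (n + 1),
      g j ((Fin.cons u z : Fin (n + 1) → I) j, (Fin.snoc z v : Fin (n + 1) → I) j) =
      pathKernel g n (u, v) := by
  induction n generalizing v with
  | zero =>
    have : ∀ z : Fin 0 → I, (Fin.snoc z v : Fin 1 → I) 0 = v := fun z => by
      simp [Fin.snoc]
    simp [pathKernel, this]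
  | succ n ih =>
    have hmp := (volume_preserving_piFinSuccAbove (fun _ : Fin (n + 1) => I) (Fin.last n)).symm
    rw [← hmp.integral_comp', Measure.volume_eq_prod, integral_prod]
    · simp only [pathKernel, kernelConv, ← ih, ← integral_mul_const]
      refine integral_congr_ae (.of_forall fun w => ?_)
      refine integral_congr_ae (.of_forall fun z => ?_)
      have h1 : (MeasurableEquiv.piFinSuccAbove (fun _ : Fin (n + 1) => I) (Fin.last n)).symm (w, z)
          = Fin.snoc z w := Fin.insertNth_last' w z
      simp only [h1]
      rw [Fin.prod_univ_castSucc]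
      simp only [Fin.snoc_castSucc, Fin.snoc_last, Fin.cons_snoc_eq_snoc_cons, Fin.val_castSucc,
        Fin.val_last]
    · refine BddMeas.integrable ?_ _
      refine BddMeas.comp (f := fun z : Fin (n + 1) → I => ∏ j : Fin (n + 1 + 1),
        g j ((Fin.cons u z : Fin (n + 2) → I) j, (Fin.snoc z v : Fin (n + 2) → I) j)) ?_
        (MeasurableEquiv.measurable _)
      refine (PosBdd.prod _ (f := fun (j : Fin (n + 1 + 1)) (z : Fin (n + 1) → I) =>
        g j ((Fin.cons u z : Fin (n + 2) → I) j, (Fin.snoc z v : Fin (n + 2) → I) j))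
        fun j => (hg j).comp (Measurable.prodMk ?_ ?_)).bddMeas
      · refine Fin.cases ?_ (fun i => ?_) j
        · simp
        · simpa using measurable_pi_apply i
      · refine Fin.lastCases ?_ (fun i => ?_) j
        · simp
        · simpa using measurable_pi_apply i

/-- The vertices of `V` are split into those of `V₁` and `n` further ones. -/
lemma integral_comp_sum_equiv {V V₁ : Type} [Fintype V] [Fintype V₁] {n : ℕ}
    (e : V₁ ⊕ Fin n ≃ V) (Φ : (V₁ → I) × (Fin n → I) → ℝ) (hΦ : PosBdd Φ) :
    ∫ x : V → I, Φ (fun u => x (e (.inl u)), fun j => x (e (.inr j))) =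
      ∫ y : V₁ → I, ∫ z : Fin n → I, Φ (y, z) := by
  have h1 := (volume_measurePreserving_piCongrLeft (fun _ : V => I) e).symm
  have h2 := volume_measurePreserving_sumPiEquivProdPi (fun _ : V₁ ⊕ Fin n => I)
  rw [← integral_prod Φ (hΦ.bddMeas.integrable _), ← Measure.volume_eq_prod, ← h2.integral_comp',
    ← h1.integral_comp']
  rfl

/-- The logarithmic Sidorenko inequality for edge-weighted homomorphism densities of the graph
with edges `s(src e, tgt e)`. -/
def LogSidorenko {V E : Type} [Fintype V] [Fintype E] (src tgt : E → V) : Prop :=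
  ∀ W : I × I → ℝ, EdgeDensity W → ∀ g : E → I × I → ℝ, (∀ e, PosBdd (g e)) →
    ∑ e, logRatio W (g e) ≤ Real.log (∫ x : V → I, ∏ e, g e (x (src e), x (tgt e)))

/-- The pairs `s(src e, tgt e)` enumerate the edges of `H` without repetition. -/
structure Orients {V E : Type} (src tgt : E → V) (H : SimpleGraph V) : Prop where
  inj : ∀ e f, s(src e, tgt e) = s(src f, tgt f) → e = f
  mem_edgeSet_iff : ∀ p, p ∈ H.edgeSet ↔ ∃ e, s(src e, tgt e) = p

lemma logSidorenko_singleEdge :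
    LogSidorenko (V := Fin 2) (E := Unit) (fun _ => 0) (fun _ => 1) := by
  intro W hW g hg
  have h := integral_mul_log_sub_log_le hW.posBdd (hg ()) volume
  rw [hW.total, one_mul, Real.log_one, sub_zero] at h
  simp only [Finset.univ_unique, PUnit.default_eq_unit, Finset.sum_singleton, Finset.prod_singleton]
  refine h.trans_eq (congrArg Real.log ?_)
  rw [← (volume_preserving_finTwoArrow I).integral_comp']
  rfl

/-- Gluing an even cycle along the edge `ab` preserves the logarithmic Sidorenko inequality. -/
lemma LogSidorenko.addPath {V V₁ E₁ : Type} [Fintype V] [Fintype V₁] [Fintype E₁]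
    {src₁ tgt₁ : E₁ → V₁} (h₁ : LogSidorenko src₁ tgt₁) {a b : V₁} {e₀ : E₁}
    (he₀ : s(src₁ e₀, tgt₁ e₀) = s(a, b)) (l : ℕ) (ι : V₁ ⊕ Fin (2 * l) ≃ V)
    {s t : Fin (2 * l + 1) → V} (hs₀ : s 0 = ι (.inl b)) (hs : ∀ j, s (Fin.succ j) = ι (.inr j))
    (ht₀ : t (Fin.last _) = ι (.inl a)) (ht : ∀ j, t (Fin.castSucc j) = ι (.inr j)) :
    LogSidorenko (Sum.elim (fun e => ι (.inl (src₁ e))) s)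
      (Sum.elim (fun e => ι (.inl (tgt₁ e))) t) := by
  classical
  intro W hW g hg
  let γ : ℕ → I × I → ℝ := fun n => g (.inr (Fin.ofNat _ n))
  have hγ : ∀ n, PosBdd (γ n) := fun n => hg _
  have hγg : ∀ j : Fin (2 * l + 1), γ j = g (.inr j) := fun j => by simp [γ]
  set h := pathKernel γ (2 * l) with hh
  have hhp : PosBdd h := PosBdd.pathKernel hγ _
  obtain ⟨k, hk, hkh, hkW⟩ : ∃ k : I × I → ℝ, PosBdd k ∧
      (∀ y : V₁ → I, k (y (src₁ e₀), y (tgt₁ e₀)) = h (y b, y a)) ∧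
      ∫ p, W p * Real.log (k p) = ∫ p, W p * Real.log (h p) := by
    rcases Sym2.eq_iff.1 he₀ with ⟨h1, h2⟩ | ⟨h1, h2⟩
    · refine ⟨fun p => h p.swap, hhp.comp measurable_swap, fun y => by rw [h1, h2]; rfl, ?_⟩
      rw [← integral_comp_swap (fun p => W p * Real.log (h p))]
      have : ∀ p : I × I, W p.swap = W p := fun p => hW.symm _ _
      simp only [this]
    · exact ⟨h, hhp, fun y => by rw [h1, h2], rfl⟩
  let g₁ : E₁ → I × I → ℝ := fun e p => g (.inl e) p * if e = e₀ then k p else 1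
  have hg₁ : ∀ e, PosBdd (g₁ e) := fun e => by
    by_cases he : e = e₀
    · simpa only [g₁, he, if_true] using (hg _).mul hk
    · simpa only [g₁, he, if_false, mul_one] using hg _
  have hint : ∫ x : V → I, ∏ e, g e (x (Sum.elim (fun e => ι (.inl (src₁ e))) s e),
      x (Sum.elim (fun e => ι (.inl (tgt₁ e))) t e)) =
      ∫ y : V₁ → I, ∏ e, g₁ e (y (src₁ e), y (tgt₁ e)) := by
    let Φ : (V₁ → I) × (Fin (2 * l) → I) → ℝ := fun q =>
      (∏ e, g (.inl e) (q.1 (src₁ e), q.1 (tgt₁ e))) * ∏ j : Fin (2 * l + 1),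
        γ j ((Fin.cons (q.1 b) q.2 : Fin (2 * l + 1) → I) j,
          (Fin.snoc q.2 (q.1 a) : Fin (2 * l + 1) → I) j)
    have hΦ : PosBdd Φ := by
      refine (PosBdd.prod _ fun e => (hg _).comp (by fun_prop)).mul
        (PosBdd.prod _ fun j => (hγ j).comp (Measurable.prodMk ?_ ?_))
      · refine Fin.cases ?_ (fun i => ?_) j
        · simp only [Fin.cons_zero]; fun_prop
        · simp only [Fin.cons_succ]; fun_prop
      · refine Fin.lastCases ?_ (fun i => ?_) j
        · simp only [Fin.snoc_last]; fun_prop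
        · simp only [Fin.snoc_castSucc]; fun_prop
    have hy : ∀ y : V₁ → I, ∏ e, g₁ e (y (src₁ e), y (tgt₁ e)) =
        ∫ z : Fin (2 * l) → I, Φ (y, z) := fun y => by
      simp only [Φ, integral_const_mul]
      rw [integral_path_eq_pathKernel hγ]
      simp only [g₁, Finset.prod_mul_distrib]
      rw [← hh, ← hkh y]
      congr 1
      exact (Finset.prod_ite_eq' Finset.univ e₀ fun e => k (y (src₁ e), y (tgt₁ e))).trans
        (if_pos (Finset.mem_univ _))
    simp only [hy]
    rw [← integral_comp_sum_equiv ι Φ hΦ]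
    refine integral_congr_ae (.of_forall fun x => ?_)
    simp only [Φ, Fintype.prod_sum_type, Sum.elim_inl, Sum.elim_inr]
    congr 1
    refine Finset.prod_congr rfl fun j _ => ?_
    rw [hγg]
    congr 2
    · refine Fin.cases ?_ (fun i => ?_) j
      · simp only [hs₀, Fin.cons_zero]
      · simp only [hs, Fin.cons_succ]
    · refine Fin.lastCases ?_ (fun i => ?_) j
      · simp only [ht₀, Fin.snoc_last]
      · simp only [ht, Fin.snoc_castSucc]
  rw [hint]
  refine le_trans ?_ (h₁ W hW g₁ hg₁)
  have hl : ∀ e, logRatio W (g₁ e) = logRatio W (g (.inl e)) +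
      if e = e₀ then ∫ p, W p * Real.log (h p) else 0 := fun e => by
    by_cases he : e = e₀
    · simp only [g₁, he, if_true]
      rw [← hkW]
      unfold logRatio
      rw [← integral_add
        ((hW.posBdd.bddMeas.mul ((hg (.inl e₀)).log.sub hW.posBdd.log)).integrable _)
        ((hW.posBdd.bddMeas.mul hk.log).integrable _)]
      refine integral_congr_ae (.of_forall fun p => ?_)
      beta_reduce
      rw [Real.log_mul ((hg _).pos p).ne' (hk.pos p).ne']
      ring
    · simp only [g₁, he, if_false, mul_one, add_zero]
  simp only [hl, Finset.sum_add_distrib, Finset.sum_ite_eq', Finset.mem_univ, if_true,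
    Fintype.sum_sum_type]
  have hc := hW.sum_logRatio_le_integral_log_pathKernel hγ l
  rw [Finset.sum_range] at hc
  simp only [hγg] at hc
  linarith

/-- A cycle graph is traversed from either end point of any of its edges. -/
lemma exists_cycle_param {V : Type} {H : SimpleGraph V} {k : ℕ}
    (ψ : H ≃g SimpleGraph.cycleGraph (k + 2)) {a b : V} (hab : H.Adj a b) :
    ∃ p : Fin (k + 2) ≃ V, p 0 = b ∧ p (Fin.last _) = a ∧
      ∀ i j, H.Adj (p i) (p j) ↔ i - j = 1 ∨ j - i = 1 := by
  have h := ψ.map_adj_iff.2 hab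
  have hlast : Fin.last (k + 1) = -1 := by
    rw [eq_neg_iff_add_eq_zero, Fin.last_add_one]
  rw [SimpleGraph.cycleGraph_adj] at h
  rcases h with h | h
  · refine ⟨(Equiv.subLeft (ψ b)).trans ψ.symm.toEquiv, ?_, ?_, fun i j => ?_⟩
    · simp
    · have : ψ b - Fin.last (k + 1) = ψ a := by
        rw [hlast, sub_neg_eq_add, ← h]; abel
      simp [this]
    · have := ψ.symm.map_adj_iff (v := ψ b - i) (w := ψ b - j)
      simp only [SimpleGraph.cycleGraph_adj, sub_sub_sub_cancel_left] at this
      exact this.trans or_comm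
  · refine ⟨(Equiv.addRight (ψ b)).trans ψ.symm.toEquiv, ?_, ?_, fun i j => ?_⟩
    · simp
    · have : Fin.last (k + 1) + ψ b = ψ a := by
        rw [hlast, ← h]; abel
      simp [this]
    · have := ψ.symm.map_adj_iff (v := i + ψ b) (w := j + ψ b)
      simp only [SimpleGraph.cycleGraph_adj, add_sub_add_right_eq_sub] at this
      exact this

/-- A graph with an enumeration of its edges satisfying the logarithmic Sidorenko inequality. -/
def IsLogSidorenko {V : Type} [Fintype V] (H : SimpleGraph V) : Prop :=
  ∃ (E : Type) (_ : Fintype E) (src tgt : E → V), Orients src tgt H ∧ LogSidorenko src tgt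

lemma isLogSidorenko_top_fin_two : IsLogSidorenko (⊤ : SimpleGraph (Fin 2)) := by
  refine ⟨Unit, inferInstance, fun _ => 0, fun _ => 1, ⟨fun _ _ _ => rfl, fun p => ?_⟩,
    logSidorenko_singleEdge⟩
  induction p with
  | _ x y => fin_cases x <;> fin_cases y <;> simp

lemma IsLogSidorenko.glue {V₁ V₂ V : Type} [Fintype V₁] [Fintype V] {H₁ : SimpleGraph V₁}
    {H₂ : SimpleGraph V₂} {H : SimpleGraph V} {a₁ b₁ : V₁} {a₂ b₂ : V₂}
    (he₁ : H₁.Adj a₁ b₁) (he₂ : H₂.Adj a₂ b₂) {i₁ : V₁ → V} {i₂ : V₂ → V}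
    (hinj₁ : Function.Injective i₁) (hinj₂ : Function.Injective i₂)
    (hcover : ∀ v : V, (∃ u, i₁ u = v) ∨ (∃ u, i₂ u = v))
    (ha : i₁ a₁ = i₂ a₂) (hb : i₁ b₁ = i₂ b₂)
    (hmeet : ∀ u₁ u₂, i₁ u₁ = i₂ u₂ → (u₁ = a₁ ∧ u₂ = a₂) ∨ (u₁ = b₁ ∧ u₂ = b₂))
    (hadj : ∀ v w : V, H.Adj v w ↔
      ((∃ u₁ u₂, i₁ u₁ = v ∧ i₁ u₂ = w ∧ H₁.Adj u₁ u₂) ∨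
        (∃ u₁ u₂, i₂ u₁ = v ∧ i₂ u₂ = w ∧ H₂.Adj u₁ u₂)))
    (h₁ : IsLogSidorenko H₁) {m : ℕ} (hm : 2 ≤ m)
    (h₂ : Nonempty (H₂ ≃g SimpleGraph.cycleGraph (2 * m))) : IsLogSidorenko H := by
  obtain ⟨l, rfl⟩ : ∃ l, m = l + 1 := ⟨m - 1, by omega⟩
  obtain ⟨ψ⟩ := h₂
  obtain ⟨E₁, _, src₁, tgt₁, ho, hL⟩ := h₁
  obtain ⟨p, hp0, hpl, hpadj⟩ := exists_cycle_param (k := 2 * l) ψ he₂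
  obtain ⟨e₀, he₀⟩ := (ho.mem_edgeSet_iff s(a₁, b₁)).1 he₁
  have hmeet' : ∀ u i, i₁ u = i₂ (p i) → i = 0 ∨ i = Fin.last _ := fun u i h => by
    rcases hmeet _ _ h with ⟨-, h⟩ | ⟨-, h⟩
    · exact .inr (p.injective (h.trans hpl.symm))
    · exact .inl (p.injective (h.trans hp0.symm))
  let q : Fin (2 * l) → V := fun j => i₂ (p j.succ.castSucc)
  have hq : ∀ u j, i₁ u ≠ q j := fun u j h => by
    rcases hmeet' _ _ h with h | h
    · simp [Fin.ext_iff] at h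
    · have := congrArg Fin.val h
      simp at this
      omega
  have hbij : Function.Bijective (Sum.elim i₁ q) := by
    constructor
    · rintro (u | j) (u' | j') h
      · exact congrArg _ (hinj₁ h)
      · exact absurd h (hq u j')
      · exact absurd h.symm (hq u' j)
      · have := p.injective (hinj₂ h)
        simp only [Fin.castSucc_inj, Fin.succ_inj] at this
        rw [this]
    · intro v
      rcases hcover v with ⟨u, hu⟩ | ⟨u, hu⟩
      · exact ⟨.inl u, hu⟩
      · obtain ⟨i, rfl⟩ := p.surjective u
        rcases Fin.eq_castSucc_or_eq_last i with ⟨i, rfl⟩ | rfl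
        · rcases Fin.eq_zero_or_eq_succ i with rfl | ⟨j, rfl⟩
          · refine ⟨.inl b₁, ?_⟩
            rw [Sum.elim_inl, hb, ← hu, ← hp0]
            rfl
          · exact ⟨.inr j, hu⟩
        · refine ⟨.inl a₁, ?_⟩
          rw [Sum.elim_inl, ha, ← hu, ← hpl]
  let ι := Equiv.ofBijective _ hbij
  let s : Fin (2 * l + 1) → V := fun j => i₂ (p j.castSucc)
  let t : Fin (2 * l + 1) → V := fun j => i₂ (p j.succ)
  have hedge : ∀ j : Fin (2 * l + 1), H₂.Adj (p j.castSucc) (p j.succ) := fun j => by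
    rw [hpadj]
    right
    rw [sub_eq_iff_eq_add', Fin.coeSucc_eq_succ.symm]
  refine ⟨E₁ ⊕ Fin (2 * l + 1), inferInstance, Sum.elim (fun e => i₁ (src₁ e)) s,
    Sum.elim (fun e => i₁ (tgt₁ e)) t, ⟨?_, ?_⟩, ?_⟩
  · have hne : ∀ e j, s(i₁ (src₁ e), i₁ (tgt₁ e)) ≠ s(s j, t j) := fun e j h => by
      have h' : (∃ u, i₁ u = i₂ (p j.castSucc)) ∧ ∃ u, i₁ u = i₂ (p j.succ) := by
        rcases Sym2.eq_iff.1 h with ⟨x, y⟩ | ⟨x, y⟩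
        · exact ⟨⟨_, x⟩, ⟨_, y⟩⟩
        · exact ⟨⟨_, y⟩, ⟨_, x⟩⟩
      obtain ⟨⟨u, hu⟩, ⟨u', hu'⟩⟩ := h'
      have h1 := hmeet' _ _ hu
      have h2 := hmeet' _ _ hu'
      simp only [Fin.ext_iff, Fin.val_castSucc, Fin.val_succ, Fin.val_zero, Fin.val_last] at h1 h2
      omega
    rintro (e | j) (e' | j') h
    · refine congrArg _ (ho.inj _ _ (Sym2.map.injective hinj₁ ?_))
      exact h
    · exact absurd h (hne e j')
    · exact absurd h.symm (hne e' j)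
    · refine congrArg _ ?_
      rcases Sym2.eq_iff.1 h with ⟨x, -⟩ | ⟨x, y⟩
      · exact Fin.castSucc_injective _ (p.injective (hinj₂ x))
      · have h1 := p.injective (hinj₂ x)
        have h2 := p.injective (hinj₂ y)
        simp only [Fin.ext_iff, Fin.val_castSucc, Fin.val_succ] at h1 h2
        omega
  · have hE₁ : ∀ u u', H₁.Adj u u' → ∃ e, s(i₁ (src₁ e), i₁ (tgt₁ e)) = s(i₁ u, i₁ u') :=
      fun u u' h => by
        obtain ⟨e, he⟩ := (ho.mem_edgeSet_iff s(u, u')).1 h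
        exact ⟨e, congrArg (Sym2.map i₁) he⟩
    have hE₂ : ∀ i j : Fin (2 * l + 2), j - i = 1 →
        ∃ e, s(Sum.elim (fun e => i₁ (src₁ e)) s e, Sum.elim (fun e => i₁ (tgt₁ e)) t e) =
          s(i₂ (p i), i₂ (p j)) := fun i j h => by
      rw [sub_eq_iff_eq_add'] at h
      subst h
      rcases Fin.eq_castSucc_or_eq_last i with ⟨i, rfl⟩ | rfl
      · exact ⟨.inr i, by rw [Fin.coeSucc_eq_succ]; rfl⟩
      · obtain ⟨e, he⟩ := hE₁ _ _ he₁
        refine ⟨.inl e, ?_⟩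
        rw [Fin.last_add_one, hp0, hpl, ← ha, ← hb]
        exact he
    intro r
    induction r with
    | _ v w =>
    rw [SimpleGraph.mem_edgeSet, hadj]
    constructor
    · rintro (⟨u, u', rfl, rfl, h⟩ | ⟨u, u', rfl, rfl, h⟩)
      · obtain ⟨e, he⟩ := hE₁ _ _ h
        exact ⟨.inl e, he⟩
      · obtain ⟨i, rfl⟩ := p.surjective u
        obtain ⟨j, rfl⟩ := p.surjective u'
        rcases (hpadj i j).1 h with h | h
        · obtain ⟨e, he⟩ := hE₂ _ _ h
          exact ⟨e, he.trans Sym2.eq_swap⟩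
        · exact hE₂ _ _ h
    · rintro ⟨e | j, h⟩
      · have hadj₁ : H₁.Adj (src₁ e) (tgt₁ e) := (ho.mem_edgeSet_iff _).2 ⟨e, rfl⟩
        rcases Sym2.eq_iff.1 h with ⟨x, y⟩ | ⟨x, y⟩
        · exact .inl ⟨_, _, x, y, hadj₁⟩
        · exact .inl ⟨_, _, y, x, hadj₁.symm⟩
      · rcases Sym2.eq_iff.1 h with ⟨x, y⟩ | ⟨x, y⟩
        · exact .inr ⟨_, _, x, y, hedge j⟩
        · exact .inr ⟨_, _, y, x, (hedge j).symm⟩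
  · refine hL.addPath he₀ l ι (s := s) (t := t) ?_ (fun j => rfl) ?_ (fun j => ?_)
    · change i₂ (p 0) = i₁ b₁
      rw [hp0, hb]
    · change i₂ (p (Fin.last _)) = i₁ a₁
      rw [hpl, ha]
    · change i₂ (p j.castSucc.succ) = i₂ (p j.succ.castSucc)
      rw [Fin.succ_castSucc]

lemma isLogSidorenko_evenCycle {V : Type} [Fintype V] {H : SimpleGraph V} {m : ℕ} (hm : 2 ≤ m)
    (hiso : Nonempty (H ≃g SimpleGraph.cycleGraph (2 * m))) : IsLogSidorenko H := by
  obtain ⟨a, b, hab⟩ : ∃ a b, H.Adj a b := by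
    obtain ⟨l, rfl⟩ : ∃ l, m = l + 1 := ⟨m - 1, by omega⟩
    obtain ⟨ψ⟩ := hiso
    refine ⟨ψ.symm (0 : Fin (2 * l + 2)), ψ.symm (1 : Fin (2 * l + 2)), ?_⟩
    rw [ψ.symm.map_adj_iff]
    exact (SimpleGraph.cycleGraph_adj (n := 2 * l)).2 (.inr (sub_zero _))
  refine isLogSidorenko_top_fin_two.glue (a₁ := 0) (b₁ := 1) (H₂ := H) (i₁ := ![a, b]) (i₂ := id)
    (by simp) hab ?_ Function.injective_id (fun v => .inr ⟨v, rfl⟩) rfl rfl ?_ (fun v w => ?_)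
    hm hiso
  · intro x y h
    fin_cases x <;> fin_cases y <;> simp_all [hab.ne, hab.ne']
  · intro x y h
    fin_cases x
    · exact .inl ⟨rfl, h.symm⟩
    · exact .inr ⟨rfl, h.symm⟩
  · constructor
    · exact fun h => .inr ⟨v, w, rfl, rfl, h⟩
    · rintro (⟨x, y, rfl, rfl, h⟩ | ⟨x, y, rfl, rfl, h⟩)
      · fin_cases x <;> fin_cases y <;> simp_all [hab.symm]
      · exact h

lemma GluedEvenCycles.isLogSidorenko {V : Type} {H : SimpleGraph V} (h : GluedEvenCycles V H) :
    ∀ [Fintype V], IsLogSidorenko H := by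
  induction h with
  | base V H m hm hiso => exact isLogSidorenko_evenCycle hm hiso
  | glue V₁ V₂ V H₁ H₂ H a₁ b₁ a₂ b₂ he₁ he₂ i₁ i₂ hinj₁ hinj₂ hcover ha hb hmeet hadj _ m hm h₂
      ih =>
    intro _
    have : Fintype V₁ := Fintype.ofInjective i₁ hinj₁
    exact ih.glue he₁ he₂ hinj₁ hinj₂ hcover ha hb hmeet hadj hm h₂

/-- Positive densities satisfy the Sidorenko inequality. -/
lemma LogSidorenko.pow_le_integral {V E : Type} [Fintype V] [Fintype E] {src tgt : E → V}
    (h : LogSidorenko src tgt) {W : I × I → ℝ} (hW : PosBdd W)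
    (hsym : ∀ x y, W (x, y) = W (y, x)) :
    (∫ p, W p) ^ Fintype.card E ≤ ∫ x : V → I, ∏ e, W (x (src e), x (tgt e)) := by
  set c := ∫ p, W p with hc
  have hc0 : 0 < c := hW.integral_pos volume
  have hW' : PosBdd (fun p => W p / c) := hW.div (PosBdd.const hc0)
  have hd : EdgeDensity (fun p => W p / c) :=
    ⟨hW', fun x y => by rw [hsym], by rw [integral_div]; exact div_self hc0.ne'⟩
  have hlog := h _ hd (fun _ p => W p / c) fun _ => hW'
  have hprod : PosBdd (fun x : V → I => ∏ e, W (x (src e), x (tgt e))) :=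
    PosBdd.prod _ fun e => hW.comp (by fun_prop)
  simp only [logRatio, sub_self, mul_zero, integral_zero, Finset.sum_const_zero,
    Finset.prod_div_distrib, Finset.prod_const, Finset.card_univ, integral_div] at hlog
  have := (Real.log_nonneg_iff (div_pos (hprod.integral_pos volume) (by positivity))).1 hlog
  rwa [one_le_div (by positivity)] at this

lemma IsLogSidorenko.isSidorenko {V : Type} [Fintype V] [DecidableEq V] {H : SimpleGraph V}
    (h : IsLogSidorenko H) : IsSidorenko H := by
  classical
  obtain ⟨E, _, src, tgt, ho, hL⟩ := h
  intro W hWm hW0 hWb hsym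
  obtain ⟨C, hC⟩ := hWb
  have hedges : H.edgeFinset = Finset.univ.image (fun e => s(src e, tgt e)) := by
    ext p
    simp [ho.mem_edgeSet_iff]
  have hcard : H.edgeFinset.card = Fintype.card E := by
    rw [hedges, Finset.card_image_of_injective _ (fun e f => ho.inj e f), Finset.card_univ]
  have hprod : ∀ x : V → I, ∏ e ∈ H.edgeFinset,
      Sym2.lift ⟨fun a b => W (x a) (x b), fun a b => hsym (x a) (x b)⟩ e =
      ∏ e, W (x (src e)) (x (tgt e)) := fun x => by
    rw [hedges, Finset.prod_image fun e _ f _ => ho.inj e f]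
    rfl
  rw [hcard]
  simp only [hprod]
  have hWB : BddMeas (Function.uncurry W) :=
    ⟨hWm, C, fun p => (abs_of_nonneg (hW0 _ _)).trans_le (hC _ _)⟩
  have hC0 : 0 ≤ C := (hW0 0 0).trans (hC 0 0)
  let ε : ℕ → ℝ := fun n => 1 / ((n : ℝ) + 1)
  have hε0 : ∀ n, 0 < ε n := fun n => by positivity
  have hε1 : ∀ n, ε n ≤ 1 := fun n => by
    simp only [ε]
    rw [div_le_one (by positivity)]
    linarith [n.cast_nonneg (α := ℝ)]
  have hεt : Filter.Tendsto ε Filter.atTop (nhds 0) := tendsto_one_div_add_atTop_nhds_zero_nat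
  have hmeas : ∀ e, Measurable fun x : V → I => W (x (src e)) (x (tgt e)) := fun e =>
    hWm.comp (f := fun x : V → I => (x (src e), x (tgt e))) (by fun_prop)
  have hlim : Filter.Tendsto
      (fun n => ∫ x : V → I, ∏ e, (W (x (src e)) (x (tgt e)) + ε n)) Filter.atTop
      (nhds (∫ x : V → I, ∏ e, W (x (src e)) (x (tgt e)))) := by
    refine tendsto_integral_of_dominated_convergence (fun _ => (C + 1) ^ Fintype.card E)
      (fun n => ?_) (integrable_const _) (fun n => .of_forall fun x => ?_)
      (.of_forall fun x => ?_)
    · exact (Finset.measurable_prod _ fun e _ => (hmeas e).add_const _).aestronglyMeasurable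
    · rw [Real.norm_of_nonneg
        (Finset.prod_nonneg fun e _ => add_nonneg (hW0 _ _) (hε0 n).le)]
      refine (Finset.prod_le_prod (fun e _ => add_nonneg (hW0 _ _) (hε0 n).le)
        fun e _ => add_le_add (hC _ _) (hε1 n)).trans_eq ?_
      rw [Finset.prod_const, Finset.card_univ]
    · refine tendsto_finsetProd _ fun e _ => ?_
      simpa using hεt.const_add (W (x (src e)) (x (tgt e)))
  refine ge_of_tendsto' hlim fun n => ?_
  have hpb : PosBdd (fun p : I × I => Function.uncurry W p + ε n) :=
    ⟨hWm.add_const _, ⟨ε n, hε0 n, fun p => le_add_of_nonneg_left (hW0 _ _)⟩, C + 1,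
      fun p => add_le_add (hC _ _) (hε1 n)⟩
  refine le_trans ?_ (hL.pow_le_integral hpb fun x y => congrArg (· + ε n) (hsym x y))
  refine pow_le_pow_left₀ (integral_nonneg fun u => integral_nonneg fun v => hW0 u v) ?_ _
  rw [show ∫ u, ∫ v, W u v = ∫ p, Function.uncurry W p from hWB.integral_prod_eq.symm]
  exact integral_mono (hWB.integrable _) (hpb.bddMeas.integrable _)
    fun p => le_add_of_nonneg_right (hε0 n).le

/-- Every graph obtained by gluing together finitely many even cycles successively along
single edges is a Sidorenko graph. -/
theorem gluedEvenCycles_sidorenko {V : Type} [Fintype V] [DecidableEq V]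
    (H : SimpleGraph V) (h : GluedEvenCycles V H) : IsSidorenko H := by
  exact h.isLogSidorenko.isSidorenko
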